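/- Let λ, μ be partitions and τ ≥ 0 an integer, and let B_0 be the bipartition whose top row is μ and whose bottom row is (λ_1 + τ, λ_2, λ_3, …). Then (a) B_0 ∈ Θ^{−,τ}_0(λ, μ); and (b) for every pair of partitions (λ', μ') with ‖λ'‖ + ‖μ'‖ = ‖λ‖ + ‖μ‖ which is strictly smaller than (λ, μ) in the ε = − order — meaning ‖μ'‖ < ‖μ‖, or ‖μ'‖ = ‖μ‖ and μ' precedes μ lexicographically, or μ' = μ and λ' precedes λ lexicographically — the bipartition B_0 does not belong to Θ^{−,τ}_k(λ', μ') for any k ≥ 0. -/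

import Mathlib

/-- The weakly decreasing rearrangement of a weakly decreasing sequence `f`
with one extra part `t` inserted. -/
def insertPart (t : ℕ) (f : ℕ → ℕ) : ℕ → ℕ
  | 0 => max (f 0) t
  | n + 1 => max (min (f n) t) (f (n + 1))

/-- A partition: a weakly decreasing sequence of naturals with
finitely many nonzero terms. -/
def IsPartition (f : ℕ → ℕ) : Prop := Antitone f ∧ ∃ N, ∀ n, N ≤ n → f n = 0

/-- The size `‖f‖` of a partition: the sum of its parts. -/
noncomputable def psize (f : ℕ → ℕ) : ℕ := ∑ᶠ n, f n

/-- Membership of the bipartition `[M; L]` in `Θ^{+,τ}_k(λ,μ)`: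
`M_i ≥ μ_i ≥ M_{i+1}`, `λ_i ≥ L_i ≥ λ_{i+1}` for all `i`, with
`‖M‖ = ‖μ‖ + τ + k` and `‖L‖ = ‖λ‖ - k`.  (All sequences are 0-indexed.) -/
def ThetaPlusMem (τ k : ℕ) (lam mu M L : ℕ → ℕ) : Prop :=
  IsPartition M ∧ IsPartition L ∧
  (∀ i, mu i ≤ M i ∧ M (i + 1) ≤ mu i) ∧
  (∀ i, L i ≤ lam i ∧ lam (i + 1) ≤ L i) ∧
  psize M = psize mu + τ + k ∧ psize L + k = psize lam

/-- Membership of the bipartition `[M; L]` in `Θ^{-,τ}_k(λ,μ)`: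
`μ_i ≥ M_i ≥ μ_{i+1}`, `L_i ≥ λ_i ≥ L_{i+1}` for all `i`, with
`‖M‖ = ‖μ‖ - k` and `‖L‖ = ‖λ‖ + τ + k`.  (All sequences are 0-indexed.) -/
def ThetaMinusMem (τ k : ℕ) (lam mu M L : ℕ → ℕ) : Prop :=
  IsPartition M ∧ IsPartition L ∧
  (∀ i, M i ≤ mu i ∧ mu (i + 1) ≤ M i) ∧
  (∀ i, lam i ≤ L i ∧ L (i + 1) ≤ lam i) ∧
  psize M + k = psize mu ∧ psize L = psize lam + τ + k

/-- Lexicographic order on sequences: `f` strictly precedes `g`. -/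
def LexLt (f g : ℕ → ℕ) : Prop := ∃ i, (∀ j, j < i → f j = g j) ∧ f i < g i

theorem psize_eq_sum_range {f : ℕ → ℕ} {N : ℕ} (h : ∀ n, N ≤ n → f n = 0) :
    psize f = ∑ n ∈ Finset.range N, f n := by
  refine finsum_eq_sum_of_support_subset f fun n hn => ?_
  by_contra hc
  exact hn (h n (by simpa using hc))

theorem psize_lt_psize {f g : ℕ → ℕ} (hg : IsPartition g) (hle : ∀ n, f n ≤ g n)
    {i : ℕ} (hi : f i < g i) : psize f < psize g := by
  obtain ⟨-, N, hN⟩ := hg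
  rw [psize_eq_sum_range hN,
    psize_eq_sum_range fun n hn => Nat.le_zero.mp ((hle n).trans (hN n hn).le)]
  refine Finset.sum_lt_sum (fun n _ => hle n) ⟨i, Finset.mem_range.mpr ?_, hi⟩
  by_contra hc
  have := hN i (not_lt.mp hc)
  omega

/-- Adding `τ` to the largest part of a partition. -/
theorem IsPartition.add_head {f : ℕ → ℕ} (hf : IsPartition f) (τ : ℕ) :
    IsPartition (fun n => if n = 0 then f 0 + τ else f n) := by
  obtain ⟨ha, N, hN⟩ := hf
  refine ⟨antitone_nat_of_succ_le fun n => ?_, N + 1, fun n hn => ?_⟩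
  · have := ha (Nat.le_succ n)
    rcases n with _ | n
    · simp at this ⊢
      omega
    · simpa using this
  · simp only [if_neg (show n ≠ 0 by omega)]
    exact hN n (by omega)

theorem psize_add_head {f : ℕ → ℕ} (hf : IsPartition f) (τ : ℕ) :
    psize (fun n => if n = 0 then f 0 + τ else f n) = psize f + τ := by
  obtain ⟨-, N, hN⟩ := hf
  rw [psize_eq_sum_range (N := N + 1) fun n hn => hN n (by omega),
    psize_eq_sum_range (N := N + 1) fun n hn => by
      simpa [show n ≠ 0 by omega] using hN n (by omega),
    Finset.sum_range_succ', Finset.sum_range_succ']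
  simp
  omega

/-- Lemma 0423, case ε = -: the bipartition `B₀` with top row `μ` and bottom
row `(λ_1 + τ, λ_2, λ_3, …)` lies in `Θ^{-,τ}_0(λ,μ)`, and it lies in no
`Θ^{-,τ}_k(λ',μ')` for any pair `(λ',μ')` of the same total size which is
smaller than `(λ,μ)` in the ε = - linear order. -/
theorem stmt10 (τ : ℕ) (lam mu : ℕ → ℕ)
    (hlam : IsPartition lam) (hmu : IsPartition mu)
    (M₀ L₀ : ℕ → ℕ)
    (hM₀ : M₀ = mu)
    (hL₀ : L₀ = fun n => if n = 0 then lam 0 + τ else lam n) :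
    ThetaMinusMem τ 0 lam mu M₀ L₀ ∧
    ∀ lam' mu' : ℕ → ℕ, IsPartition lam' → IsPartition mu' →
      psize lam' + psize mu' = psize lam + psize mu →
      (psize mu' < psize mu ∨
        (psize mu' = psize mu ∧ LexLt mu' mu) ∨
        (mu' = mu ∧ LexLt lam' lam)) →
      ∀ k : ℕ, ¬ ThetaMinusMem τ k lam' mu' M₀ L₀ := by
  subst hM₀ hL₀
  refine ⟨⟨hmu, hlam.add_head τ, fun i => ⟨le_rfl, hmu.1 (Nat.le_succ i)⟩, fun i => ⟨?_, ?_⟩,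
    rfl, by rw [psize_add_head hlam, add_zero]⟩, ?_⟩
  · dsimp only
    split_ifs with h
    · subst h
      omega
    · exact le_rfl
  · simpa using hlam.1 (Nat.le_succ i)
  · rintro lam' mu' - - hsize hlt k ⟨-, -, hM, hL, hk, -⟩
    rcases hlt with h | ⟨-, i, -, hi⟩ | ⟨rfl, i, heq, hi⟩
    · omega
    · exact absurd (hM i).1 (not_le.mpr hi)
    · have hle : ∀ n, lam' n ≤ lam n := by
        intro n
        rcases Nat.eq_zero_or_pos n with rfl | hn
        · rcases Nat.eq_zero_or_pos i with rfl | h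
          · exact hi.le
          · exact (heq 0 h).le
        · simpa [hn.ne'] using (hL n).1
      have := psize_lt_psize hlam hle hi
      omega
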